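/- arXiv:2306.02899 — 8 statements merged into one kernel-verified Lean document; each statement's English description precedes it below -/
import Mathlib

section
/- Let G1 and G2 be DAGs on the same vertex set that are isolated equivalent, and let 𝓘1 be any family of single-node hard intervention targets. Then there exists a family 𝓘2 of single-node hard intervention targets such that {𝒯(G1^(I)) : I ∈ 𝓘1} = {𝒯(G2^(J)) : J ∈ 𝓘2} as sets. -/
universe u

/-- Acyclicity of a directed graph given by its edge relation. -/
def IsDAG {V : Type u} (E : V → V → Prop) : Prop :=
  ∀ v : V, ¬ Relation.TransGen E v v

/-- Hard intervention with target set `I`: delete every edge whose head lies in `I`. -/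
def intervene {V : Type u} (E : V → V → Prop) (I : Set V) : V → V → Prop :=
  fun u v => E u v ∧ v ∉ I

/-- Activity condition at an interior vertex `v` of a path, with neighbours `u` and `w`:
if `v` is a collider (both path edges point into `v`) then `v` or one of its directed
descendants must lie in `C`; otherwise `v` must not lie in `C`. -/
def ActiveTriple {V : Type u} (E : V → V → Prop) (C : Set V) (u v w : V) : Prop :=
  ((E u v ∧ E w v) → ∃ d, Relation.ReflTransGen E v d ∧ d ∈ C) ∧
  (¬ (E u v ∧ E w v) → v ∉ C)

/-- Every interior vertex of the vertex list satisfies the activity condition. -/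
def TriplesActive {V : Type u} (E : V → V → Prop) (C : Set V) : List V → Prop
  | u :: v :: w :: rest => ActiveTriple E C u v w ∧ TriplesActive E C (v :: w :: rest)
  | _ => True

/-- `p` is an active path between `a` and `b` given the conditioning set `C`. -/
def IsActivePath {V : Type u} (E : V → V → Prop) (C : Set V) (p : List V) (a b : V) : Prop :=
  p.Nodup ∧ p.head? = some a ∧ p.getLast? = some b ∧
  List.Chain' (fun u v => E u v ∨ E v u) p ∧ TriplesActive E C p

/-- Two single vertices are d-connected given `C`. -/
def dconn {V : Type u} (E : V → V → Prop) (C : Set V) (a b : V) : Prop :=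
  ∃ p : List V, IsActivePath E C p a b

/-- Two single vertices are d-separated given `C`. -/
def dsepV {V : Type u} (E : V → V → Prop) (C : Set V) (a b : V) : Prop :=
  ¬ dconn E C a b

/-- Vertex sets `A` and `B` are d-separated given `C`. -/
def dsep {V : Type u} (E : V → V → Prop) (A B C : Set V) : Prop :=
  ∀ a ∈ A, ∀ b ∈ B, dsepV E C a b

/-- `𝒯(G)`: the set of d-separation triples of pairwise disjoint vertex sets. -/
def Tsep {V : Type u} (E : V → V → Prop) : Set (Set V × Set V × Set V) :=
  { t | Disjoint t.1 t.2.1 ∧ Disjoint t.1 t.2.2 ∧ Disjoint t.2.1 t.2.2 ∧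
        dsep E t.1 t.2.1 t.2.2 }

/-- An edge `u → v` is isolated: `u` has no parents and the only parent of `v` is `u`. -/
def IsolatedEdge {V : Type u} (E : V → V → Prop) (u v : V) : Prop :=
  E u v ∧ (∀ w, ¬ E w u) ∧ (∀ w, E w v → w = u)

/-- The graph obtained by reversing the edge `u → v`. -/
def reverseEdge {V : Type u} (E : V → V → Prop) (u v : V) : V → V → Prop :=
  fun a b => (E a b ∧ ¬ (a = u ∧ b = v)) ∨ (a = v ∧ b = u)

/-- One step of isolated-edge reversal between DAGs. -/
def IsoStep {V : Type u} (E₁ E₂ : V → V → Prop) : Prop :=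
  IsDAG E₁ ∧ IsDAG E₂ ∧ ∃ u v, IsolatedEdge E₁ u v ∧ E₂ = reverseEdge E₁ u v

/-- Isolated equivalence: a finite sequence of isolated-edge reversals,
each intermediate graph being a DAG. -/
def IsoEquiv {V : Type u} (E₁ E₂ : V → V → Prop) : Prop :=
  Relation.ReflTransGen IsoStep E₁ E₂

/-- An edge `u → v` is covered: `pa(v) = pa(u) ∪ {u}`. -/
def CoveredEdge {V : Type u} (E : V → V → Prop) (u v : V) : Prop :=
  E u v ∧ ∀ w, E w v ↔ (E w u ∨ w = u)

/-- `p` is a directed path from `a` to `b`. -/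
def IsDirPath {V : Type u} (E : V → V → Prop) (p : List V) (a b : V) : Prop :=
  p.Nodup ∧ p.head? = some a ∧ p.getLast? = some b ∧ List.Chain' E p

/-- A measurement model on observed vertices `Xs` and hidden vertices `Hs`:
a DAG in which every edge goes from a hidden vertex to an observed or hidden one
(so observed vertices have no outgoing edges and all their parents are hidden). -/
def IsMeasurementModel {V : Type u} (E : V → V → Prop) (Xs Hs : Set V) : Prop :=
  IsDAG E ∧ Disjoint Xs Hs ∧ ∀ u v, E u v → u ∈ Hs ∧ (v ∈ Xs ∨ v ∈ Hs)

/-- Observed children of a hidden vertex. -/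
def chSet {V : Type u} (E : V → V → Prop) (Xs : Set V) (h : V) : Set V :=
  {x | x ∈ Xs ∧ E h x}

/-- Undirected dependency graph on `Xs`: distinct observed vertices are adjacent iff
they are d-connected given the empty set. -/
def UDG {V : Type u} (E : V → V → Prop) (Xs : Set V) : V → V → Prop :=
  fun x x' => x ∈ Xs ∧ x' ∈ Xs ∧ x ≠ x' ∧ dconn E ∅ x x'

/-- `C` is a clique of the undirected graph `R` on vertex set `Xs`. -/
def IsCliqueIn {V : Type u} (R : V → V → Prop) (Xs C : Set V) : Prop :=
  C ⊆ Xs ∧ ∀ x ∈ C, ∀ y ∈ C, x ≠ y → R x y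

/-- `C` is an inclusion-maximal clique of `R` on `Xs`. -/
def IsMaxCliqueIn {V : Type u} (R : V → V → Prop) (Xs C : Set V) : Prop :=
  IsCliqueIn R Xs C ∧ ∀ C', IsCliqueIn R Xs C' → C ⊆ C' → C = C'

/-- The complete family of intervention targets `𝓘 = {∅} ∪ {{h} : h ∈ H}`. -/
def completeFamily {V : Type u} (Hs : Set V) : Set (Set V) :=
  insert ∅ ((fun h => ({h} : Set V)) '' Hs)

/-- `Ω_G^(I)`: the set of maximal cliques of `UDG(G^(I))`. -/
def maxCliques {V : Type u} (E : V → V → Prop) (Xs I : Set V) : Set (Set V) :=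
  {C | IsMaxCliqueIn (UDG (intervene E I) Xs) Xs C}

/-- `Ω = ⋃_{I ∈ 𝓘} Ω_G^(I)`. -/
def Omega {V : Type u} (E : V → V → Prop) (Xs Hs : Set V) : Set (Set V) :=
  ⋃ I ∈ completeFamily Hs, maxCliques E Xs I

/-- A valid subset of the observed vertices. -/
def ValidSubset {V : Type u} (E : V → V → Prop) (Xs Hs X' : Set V) : Prop :=
  X' ⊆ Xs ∧ ∀ I ∈ completeFamily Hs, ∃ C ∈ maxCliques E Xs I, X' ⊆ C

/-- A maximal valid subset. -/
def MaxValidSubset {V : Type u} (E : V → V → Prop) (Xs Hs X' : Set V) : Prop :=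
  ValidSubset E Xs Hs X' ∧
  ¬ ∃ X'', ValidSubset E Xs Hs X'' ∧ X' ⊂ X'' ∧
      ∀ C ∈ Omega E Xs Hs, X' ⊆ C → X'' ⊆ C

/-- An imaginary subset: a maximal valid subset not contained in the child set of
any hidden vertex. -/
def ImaginarySubset {V : Type u} (E : V → V → Prop) (Xs Hs X' : Set V) : Prop :=
  MaxValidSubset E Xs Hs X' ∧ ¬ ∃ h ∈ Hs, X' ⊆ chSet E Xs h

/-- A replaceable subset: a maximal valid subset strictly contained in another
maximal valid subset. -/
def ReplaceableSubset {V : Type u} (E : V → V → Prop) (Xs Hs X' : Set V) : Prop :=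
  MaxValidSubset E Xs Hs X' ∧ ∃ X'', MaxValidSubset E Xs Hs X'' ∧ X' ⊂ X''

/-- Graphical condition (c). -/
def CondC {V : Type u} (E : V → V → Prop) (Xs Hs : Set V) : Prop :=
  ∀ I ∈ completeFamily Hs, ∀ h ∈ Hs, ∀ h' ∈ Hs, h ≠ h' →
    dsepV (intervene E I) ∅ h h' →
    ∃ x ∈ chSet E Xs h, ∃ x' ∈ chSet E Xs h', dsepV (intervene E I) ∅ x x'

/-- Add an edge `a → b` to a graph. -/
def addEdge {V : Type u} (E : V → V → Prop) (a b : V) : V → V → Prop :=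
  fun u v => E u v ∨ (u = a ∧ v = b)

/-- Graphical maximality of a measurement model. -/
def GraphMaximal {V : Type u} (E : V → V → Prop) (Xs Hs : Set V) : Prop :=
  (∀ x ∈ Xs, ∃ v, E v x) ∧
  ∀ h ∈ Hs, ∀ x ∈ Xs, ¬ E h x →
    ∃ I ∈ completeFamily Hs,
      UDG (intervene (addEdge E h x) I) Xs ≠ UDG (intervene E I) Xs

/-- A clique `C` is shattered by a collection `S` if some subcollection of `S`
has union exactly `C`. -/
def Shattered {V : Type u} (S : Set (Set V)) (C : Set V) : Prop :=
  ∃ S' ⊆ S, C = ⋃₀ S'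

/-- A complete collection of maximal valid subsets: for every intervention target,
every edge of the UDG has both endpoints in some shattered maximal clique. -/
def CompleteCollection {V : Type u} (E : V → V → Prop) (Xs Hs : Set V)
    (S : Set (Set V)) : Prop :=
  (∀ s ∈ S, MaxValidSubset E Xs Hs s) ∧
  ∀ I ∈ completeFamily Hs, ∀ x x' : V, UDG (intervene E I) Xs x x' →
    ∃ C ∈ maxCliques E Xs I, x ∈ C ∧ x' ∈ C ∧ Shattered S C

/-- A fractured subset. -/
def FracturedSubset {V : Type u} (E : V → V → Prop) (Xs Hs X' : Set V) : Prop :=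
  MaxValidSubset E Xs Hs X' ∧
  ∃ S, CompleteCollection E Xs Hs S ∧ ∀ s ∈ S, ¬ s ⊆ X'

/-- The pure-child assumption. -/
def PureChild {V : Type u} (E : V → V → Prop) (Xs Hs : Set V) : Prop :=
  ∀ h ∈ Hs, ∃ x ∈ Xs, E h x ∧ ∀ w, E w x → w = h

/-- The latent DAG: the induced directed graph on the hidden vertices. -/
def latentGraph {V : Type u} (E : V → V → Prop) (Hs : Set V) : V → V → Prop :=
  fun u v => u ∈ Hs ∧ v ∈ Hs ∧ E u v

/-- A common-parent path `x1 ← h → x2`. -/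
def IsCPPath {V : Type u} (p : List V) (x1 x2 : V) : Prop :=
  ∃ h, p = [x1, h, x2]

/-- A sparse measurement model. -/
def SparseMM {V : Type u} (E : V → V → Prop) (Xs Hs : Set V) : Prop :=
  (∀ x1 ∈ Xs, ∀ x2 ∈ Xs, x1 ≠ x2 → dconn E ∅ x1 x2 →
    (∀ h ∈ Hs, ∀ h' ∈ Hs,
        x1 ∈ chSet E Xs h → x2 ∈ chSet E Xs h →
        x1 ∈ chSet E Xs h' → x2 ∈ chSet E Xs h' → h = h') ∧
    (∀ p q : List V,
        IsActivePath E ∅ p x1 x2 → ¬ IsCPPath p x1 x2 →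
        IsActivePath E ∅ q x1 x2 → ¬ IsCPPath q x1 x2 → p = q)) ∧
  (∀ x1 ∈ Xs, ∀ x2 ∈ Xs, ∀ x3 ∈ Xs, ∀ h2 ∈ Hs, ∀ h3 ∈ Hs, h2 ≠ h3 →
    x1 ∈ chSet E Xs h2 → x2 ∈ chSet E Xs h2 →
    x1 ∈ chSet E Xs h3 → x3 ∈ chSet E Xs h3 →
    ∀ p : List V, IsActivePath E ∅ p x2 x3 →
      ¬ IsCPPath p x2 x3 ∧ p[1]? = some h2 ∧ p.reverse[1]? = some h3)

namespace IsolatedEdge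

variable {V : Type u} {E : V → V → Prop} {u v : V}

theorem ne (h : IsolatedEdge E u v) : u ≠ v := by
  rintro rfl
  exact h.2.1 u h.1

theorem reverse (h : IsolatedEdge E u v) : IsolatedEdge (reverseEdge E u v) v u := by
  have hne := h.ne
  obtain ⟨_, hu, hv⟩ := h
  refine ⟨Or.inr ⟨rfl, rfl⟩, ?_, ?_⟩
  · rintro w (⟨hw, hn⟩ | ⟨-, rfl⟩)
    · exact hn ⟨hv w hw, rfl⟩
    · exact hne rfl
  · rintro w (⟨hw, -⟩ | ⟨rfl, -⟩)
    · exact absurd hw (hu w)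
    · rfl

theorem reverseEdge_reverseEdge (h : IsolatedEdge E u v) :
    reverseEdge (reverseEdge E u v) v u = E := by
  funext a b
  apply propext
  have huv := h.1
  have hvu := h.2.1 v
  unfold reverseEdge
  constructor
  · rintro (⟨⟨hab, -⟩ | hab, hn⟩ | ⟨rfl, rfl⟩)
    · exact hab
    · exact absurd hab hn
    · exact huv
  · intro hab
    by_cases hc : a = u ∧ b = v
    · exact Or.inr hc
    · refine Or.inl ⟨Or.inl ⟨hab, hc⟩, ?_⟩
      rintro ⟨rfl, rfl⟩
      exact hvu hab

theorem reverseEdge_iff {a b : V} (hu : b ≠ u) (hv : b ≠ v) :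
    reverseEdge E u v a b ↔ E a b := by
  simp [reverseEdge, hu, hv]

theorem reverseEdge_adj {a b : V} (h : E a b ∨ E b a) :
    reverseEdge E u v a b ∨ reverseEdge E u v b a := by
  unfold reverseEdge
  tauto

/-- A vertex with two distinct parents is neither endpoint of an isolated edge. -/
theorem ne_of_parents (h : IsolatedEdge E u v) {a b x : V} (ha : E a x) (hb : E b x)
    (hab : a ≠ b) : x ≠ u ∧ x ≠ v := by
  constructor
  · rintro rfl
    exact h.2.1 a ha
  · rintro rfl
    exact hab ((h.2.2 a ha).trans (h.2.2 b hb).symm)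

theorem collider_reverse (h : IsolatedEdge E u v) {a b x : V} (hab : a ≠ b)
    (hx : E a x ∧ E b x) : reverseEdge E u v a x ∧ reverseEdge E u v b x := by
  obtain ⟨hu, hv⟩ := h.ne_of_parents hx.1 hx.2 hab
  exact ⟨(reverseEdge_iff hu hv).2 hx.1, (reverseEdge_iff hu hv).2 hx.2⟩

theorem reflTransGen_reverse (h : IsolatedEdge E u v) {x d : V} (hu : x ≠ u) (hv : x ≠ v)
    (hd : Relation.ReflTransGen E x d) :
    (d ≠ u ∧ d ≠ v) ∧ Relation.ReflTransGen (reverseEdge E u v) x d := by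
  induction hd with
  | refl => exact ⟨⟨hu, hv⟩, .refl⟩
  | @tail y z _ hyz ih =>
    have hzu : z ≠ u := by
      rintro rfl
      exact h.2.1 y hyz
    have hzv : z ≠ v := by
      rintro rfl
      exact ih.1.1 (h.2.2 y hyz)
    exact ⟨⟨hzu, hzv⟩, ih.2.tail ((reverseEdge_iff hzu hzv).2 hyz)⟩

theorem activeTriple_reverse (h : IsolatedEdge E u v) {C : Set V} {a x b : V} (hab : a ≠ b)
    (hx : ActiveTriple E C a x b) : ActiveTriple (reverseEdge E u v) C a x b := by
  refine ⟨fun hc => ?_, fun hc => hx.2 fun hc' => hc (h.collider_reverse hab hc')⟩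
  have hcE : E a x ∧ E b x := by
    simpa only [h.reverseEdge_reverseEdge] using h.reverse.collider_reverse hab hc
  obtain ⟨hu, hv⟩ := h.ne_of_parents hcE.1 hcE.2 hab
  obtain ⟨d, hd, hdC⟩ := hx.1 hcE
  exact ⟨d, (h.reflTransGen_reverse hu hv hd).2, hdC⟩

theorem triplesActive_reverse (h : IsolatedEdge E u v) {C : Set V} :
    ∀ {p : List V}, p.Nodup → TriplesActive E C p → TriplesActive (reverseEdge E u v) C p
  | [], _, _ => trivial
  | [_], _, _ => trivial
  | [_, _], _, _ => trivial
  | a :: x :: b :: p, hp, hact => by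
    have hab : a ≠ b := by
      rintro rfl
      simp at hp
    exact ⟨h.activeTriple_reverse hab hact.1, h.triplesActive_reverse hp.of_cons hact.2⟩

theorem dconn_reverse (h : IsolatedEdge E u v) {C : Set V} {a b : V} (hab : dconn E C a b) :
    dconn (reverseEdge E u v) C a b := by
  obtain ⟨p, hp, ha, hb, hchain, hact⟩ := hab
  exact ⟨p, hp, ha, hb, hchain.imp fun _ _ => reverseEdge_adj, h.triplesActive_reverse hp hact⟩

theorem dconn_reverse_iff (h : IsolatedEdge E u v) {C : Set V} {a b : V} :
    dconn (reverseEdge E u v) C a b ↔ dconn E C a b :=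
  ⟨fun hab => by simpa only [h.reverseEdge_reverseEdge] using h.reverse.dconn_reverse hab,
    h.dconn_reverse⟩

theorem Tsep_reverse (h : IsolatedEdge E u v) : Tsep (reverseEdge E u v) = Tsep E := by
  simp only [Tsep, dsep, dsepV, h.dconn_reverse_iff]

theorem intervene (h : IsolatedEdge E u v) {I : Set V} (hv : v ∉ I) :
    IsolatedEdge (intervene E I) u v :=
  ⟨⟨h.1, hv⟩, fun w hw => h.2.1 w hw.1, fun w hw => h.2.2 w hw.1⟩

/-- Every single-node intervention before reversing an isolated edge is matched by
one after the reversal. -/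
theorem exists_Tsep_intervene_eq (h : IsolatedEdge E u v) {I : Set V} (hI : I.Subsingleton) :
    ∃ J : Set V, J.Subsingleton ∧
      Tsep (_root_.intervene E I) = Tsep (_root_.intervene (reverseEdge E u v) J) := by
  have hne := h.ne
  by_cases hu : u ∈ I
  · refine ⟨∅, Set.subsingleton_empty, ?_⟩
    have h₁ : _root_.intervene E I = E := by
      funext a b
      refine propext ⟨fun hab => hab.1, fun hab => ⟨hab, fun hb => ?_⟩⟩
      exact h.2.1 a (hI hb hu ▸ hab)
    have h₂ : _root_.intervene (reverseEdge E u v) ∅ = reverseEdge E u v := by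
      funext a b
      simp [_root_.intervene]
    rw [h₁, h₂, h.Tsep_reverse]
  by_cases hv : v ∈ I
  · refine ⟨{u}, Set.subsingleton_singleton, congrArg Tsep ?_⟩
    obtain rfl := hI.eq_singleton_of_mem hv
    funext a b
    have h₁ := h.2.1 a
    have h₂ := h.2.2 a
    simp only [_root_.intervene, reverseEdge, Set.mem_singleton_iff, eq_iff_iff]
    constructor
    · rintro ⟨hab, hb⟩
      refine ⟨Or.inl ⟨hab, fun hc => hb hc.2⟩, ?_⟩
      rintro rfl
      exact h₁ hab
    · rintro ⟨⟨hab, hn⟩ | ⟨_, hb⟩, hbu⟩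
      · refine ⟨hab, ?_⟩
        rintro rfl
        exact hn ⟨h₂ hab, rfl⟩
      · exact absurd hb hbu
  · refine ⟨I, hI, ?_⟩
    have hrev : _root_.intervene (reverseEdge E u v) I =
        reverseEdge (_root_.intervene E I) u v := by
      funext a b
      refine propext ⟨?_, ?_⟩
      · rintro ⟨⟨hab, hn⟩ | hab, hb⟩
        · exact Or.inl ⟨⟨hab, hb⟩, hn⟩
        · exact Or.inr hab
      · rintro (⟨⟨hab, hb⟩, hn⟩ | ⟨rfl, rfl⟩)
        · exact ⟨Or.inl ⟨hab, hn⟩, hb⟩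
        · exact ⟨Or.inr ⟨rfl, rfl⟩, hu⟩
    rw [hrev, (h.intervene hv).Tsep_reverse]

end IsolatedEdge

theorem IsoEquiv.exists_Tsep_intervene_eq {V : Type u} {E₁ E₂ : V → V → Prop}
    (h : IsoEquiv E₁ E₂) {I : Set V} (hI : I.Subsingleton) :
    ∃ J : Set V, J.Subsingleton ∧ Tsep (intervene E₁ I) = Tsep (intervene E₂ J) := by
  induction h with
  | refl => exact ⟨I, hI, rfl⟩
  | tail _ hstep ih =>
    obtain ⟨J, hJ, hIJ⟩ := ih
    obtain ⟨-, -, u, v, huv, rfl⟩ := hstep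
    obtain ⟨K, hK, hJK⟩ := huv.exists_Tsep_intervene_eq hJ
    exact ⟨K, hK, hIJ.trans hJK⟩

/-- If `G1` and `G2` are isolated-equivalent DAGs, then for any family of
single-node hard intervention targets `𝓘1` there is a family `𝓘2` such that the sets of
induced d-separation structures coincide. -/
theorem statement1 {V : Type u} [Fintype V] (E1 E2 : V → V → Prop)
    (hd1 : IsDAG E1) (hd2 : IsDAG E2) (hiso : IsoEquiv E1 E2)
    (I1fam : Set (Set V)) (hI1 : ∀ I ∈ I1fam, I.Subsingleton) :
    ∃ I2fam : Set (Set V), (∀ J ∈ I2fam, J.Subsingleton) ∧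
      {T : Set (Set V × Set V × Set V) | ∃ I ∈ I1fam, T = Tsep (intervene E1 I)} =
      {T : Set (Set V × Set V × Set V) | ∃ J ∈ I2fam, T = Tsep (intervene E2 J)} := by
  refine ⟨{J | J.Subsingleton ∧ ∃ I ∈ I1fam, Tsep (intervene E1 I) = Tsep (intervene E2 J)},
    fun J hJ => hJ.1, Set.ext fun T => ⟨?_, ?_⟩⟩
  · rintro ⟨I, hI, rfl⟩
    obtain ⟨J, hJ, hIJ⟩ := hiso.exists_Tsep_intervene_eq (hI1 I hI)
    exact ⟨J, ⟨hJ, I, hI, hIJ⟩, hIJ⟩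
  · rintro ⟨J, ⟨-, I, hI, hIJ⟩, rfl⟩
    exact ⟨I, hI, hIJ.symm⟩
end

section
/- Let G1 and G2 be DAGs on the same vertex set with 𝒯(G1) = 𝒯(G2) (Markov equivalent) that are not isolated equivalent. Then there exists a single-node hard intervention target I1 such that for every single-node hard intervention target I2, 𝒯(G1^(I1)) ≠ 𝒯(G2^(I2)). -/
universe u

/-- Adjacency in the skeleton of a directed graph. -/
def SkelAdj {V : Type u} (E : V → V → Prop) (a b : V) : Prop :=
  E a b ∨ E b a

theorem IsDAG.asymm {V : Type u} {E : V → V → Prop} (hd : IsDAG E) {a b : V}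
    (h : E a b) : ¬ E b a :=
  fun h' => hd a ((Relation.TransGen.single h).tail h')

theorem IsDAG.irrefl {V : Type u} {E : V → V → Prop} (hd : IsDAG E) (a : V) : ¬ E a a :=
  fun h => hd a (.single h)

theorem IsDAG.intervene {V : Type u} {E : V → V → Prop} (hd : IsDAG E) (I : Set V) :
    IsDAG (intervene E I) :=
  fun v h => hd v (Relation.TransGen.mono (fun _ _ h => h.1) _ _ h)

/-- A path leaving `a` through a child that is active given the parents of `a`
is directed, so it ends in a descendant of `a`. -/
theorem transGen_of_triplesActive_parents {V : Type u} {E : V → V → Prop} (hd : IsDAG E)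
    {a b : V} (l : List V) (u v : V) (huv : E u v) (hav : Relation.TransGen E a v)
    (hc : List.IsChain (fun u v => E u v ∨ E v u) (u :: v :: l))
    (ht : TriplesActive E {w | E w a} (u :: v :: l))
    (hb : (u :: v :: l).getLast? = some b) : Relation.TransGen E a b := by
  induction l generalizing u v with
  | nil =>
    obtain rfl : v = b := by simpa using hb
    exact hav
  | cons w l ih =>
    obtain ⟨⟨hcol, -⟩, ht⟩ := ht
    have hc' := (List.isChain_cons_cons.1 hc).2
    rcases (List.isChain_cons_cons.1 hc').1 with hvw | hwv
    · exact ih v w hvw (hav.tail hvw) hc' ht (by simpa using hb)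
    · obtain ⟨d, hvd, hda⟩ := hcol ⟨huv, hwv⟩
      exact (hd a ((hav.trans_left hvd).tail hda)).elim

/-- A vertex is d-separated from every non-adjacent non-descendant given its parents. -/
theorem dsepV_parents {V : Type u} {E : V → V → Prop} (hd : IsDAG E) {a b : V}
    (hab : a ≠ b) (hadj : ¬ SkelAdj E a b) (hdesc : ¬ Relation.TransGen E a b) :
    dsepV E {w | E w a} a b := by
  rintro ⟨p, -, hhead, hlast, hc, ht⟩
  match p, hhead, hlast, hc, ht with
  | [x], hhead, hlast, _, _ =>
    simp only [List.head?_cons, List.getLast?_singleton, Option.some.injEq] at hhead hlast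
    exact hab (hhead.symm.trans hlast)
  | x :: w :: l, hhead, hlast, hc, ht =>
    obtain rfl : x = a := by simpa using hhead
    rcases (List.isChain_cons_cons.1 hc).1 with h | h
    · exact hdesc (transGen_of_triplesActive_parents hd l x w h (.single h) hc ht hlast)
    · match l, hlast, ht with
      | [], hlast, _ =>
        obtain rfl : w = b := by simpa using hlast
        exact hadj (.inr h)
      | _ :: _, _, ht => exact ht.1.2 (fun h' => hd.asymm h h'.1) h

theorem mem_Tsep_parents {V : Type u} {E : V → V → Prop} (hd : IsDAG E) {a b : V}
    (hab : a ≠ b) (hadj : ¬ SkelAdj E a b) (hdesc : ¬ Relation.TransGen E a b) :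
    (({a}, {b}, {w | E w a}) : Set V × Set V × Set V) ∈ Tsep E := by
  refine ⟨by simpa using hab, by simpa using hd.irrefl a,
    by simpa using fun h => hadj (.inr h), ?_⟩
  rintro _ rfl _ rfl
  exact dsepV_parents hd hab hadj hdesc

theorem notMem_Tsep_of_skelAdj {V : Type u} {E : V → V → Prop} {a b : V} (hab : a ≠ b)
    (hadj : SkelAdj E a b) (C : Set V) :
    (({a}, {b}, C) : Set V × Set V × Set V) ∉ Tsep E := fun h =>
  h.2.2.2 a rfl b rfl
    ⟨[a, b], by simpa using hab, rfl, rfl, List.isChain_pair.2 hadj, trivial⟩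

/-- In a DAG, distinct vertices are adjacent iff no set d-separates them. -/
theorem skelAdj_iff_forall_notMem_Tsep {V : Type u} {E : V → V → Prop} (hd : IsDAG E) {a b : V}
    (hab : a ≠ b) :
    SkelAdj E a b ↔ ∀ C : Set V, (({a}, {b}, C) : Set V × Set V × Set V) ∉ Tsep E ∧
      (({b}, {a}, C) : Set V × Set V × Set V) ∉ Tsep E := by
  refine ⟨fun h C => ⟨notMem_Tsep_of_skelAdj hab h C,
    notMem_Tsep_of_skelAdj hab.symm h.symm C⟩, fun h => ?_⟩
  by_contra hadj
  by_cases hdesc : Relation.TransGen E a b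
  · exact (h _).2 (mem_Tsep_parents hd hab.symm (fun h' => hadj h'.symm)
      fun h' => hd a (hdesc.trans h'))
  · exact (h _).1 (mem_Tsep_parents hd hab hadj hdesc)

/-- Markov equivalent DAGs have the same skeleton. -/
theorem skelAdj_iff_of_Tsep_eq {V : Type u} {E1 E2 : V → V → Prop} (hd1 : IsDAG E1)
    (hd2 : IsDAG E2) (h : Tsep E1 = Tsep E2) (a b : V) : SkelAdj E1 a b ↔ SkelAdj E2 a b := by
  rcases eq_or_ne a b with rfl | hab
  · simp [SkelAdj, hd1.irrefl, hd2.irrefl]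
  · rw [skelAdj_iff_forall_notMem_Tsep hd1 hab, skelAdj_iff_forall_notMem_Tsep hd2 hab, h]

/-- Reversing an isolated edge preserves acyclicity. -/
theorem IsDAG.reverseEdge {V : Type u} {E : V → V → Prop} (hd : IsDAG E) {p x : V}
    (h : IsolatedEdge E p x) : IsDAG (reverseEdge E p x) := by
  obtain ⟨hpx, hp, hx⟩ := h
  have hne : p ≠ x := fun h => hp p (h ▸ hpx)
  have key : ∀ u v, Relation.TransGen (_root_.reverseEdge E p x) u v →
      v ≠ x ∧ (v = p → u = x) ∧ (v ≠ p → u = x ∨ Relation.TransGen E u v) := by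
    intro u v huv
    induction huv with
    | single h =>
      rcases h with ⟨h, h'⟩ | ⟨rfl, rfl⟩
      · exact ⟨by rintro rfl; exact h' ⟨hx _ h, rfl⟩, by rintro rfl; exact (hp _ h).elim,
          fun _ => .inr (.single h)⟩
      · exact ⟨hne, fun _ => rfl, fun _ => .inl rfl⟩
    | @tail b c _ h ih =>
      rcases h with ⟨h, h'⟩ | ⟨rfl, rfl⟩
      · refine ⟨by rintro rfl; exact h' ⟨hx _ h, rfl⟩, by rintro rfl; exact (hp _ h).elim,
          fun _ => ?_⟩
        by_cases hb : b = p
        · exact .inl (ih.2.1 hb)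
        · exact (ih.2.2 hb).imp_right fun hu => hu.tail h
      · exact (ih.1 rfl).elim
  intro v hv
  obtain ⟨h1, h2, h3⟩ := key v v hv
  by_cases hvp : v = p
  · exact h1 (h2 hvp)
  · exact (h3 hvp).elim h1 (hd v)

/-- For each edge `p → x` of `E1`, either `x` has the same parents in both graphs, or `p` is the
only parent of `x` in `E1` while `x` is the only parent of `p` in `E2`. -/
def ParentsMatchOrSwap {V : Type u} (E1 E2 : V → V → Prop) : Prop :=
  ∀ p x, E1 p x → (∀ q, E2 q x ↔ E1 q x) ∨
    (E2 x p ∧ (∀ q, E2 q p → q = x) ∧ ∀ q, E1 q x → q = p)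

theorem parentsMatchOrSwap_of_intervene {V : Type u} {E1 E2 : V → V → Prop} (hd1 : IsDAG E1)
    (hd2 : IsDAG E2) (hs : ∀ a b, SkelAdj E1 a b ↔ SkelAdj E2 a b)
    (h : ∀ I1 : Set V, I1.Subsingleton → ∃ I2 : Set V, I2.Subsingleton ∧
      Tsep (intervene E1 I1) = Tsep (intervene E2 I2)) : ParentsMatchOrSwap E1 E2 := by
  intro p x hpx
  obtain ⟨I2, hI2, hT⟩ := h {x} Set.subsingleton_singleton
  have hI := skelAdj_iff_of_Tsep_eq (hd1.intervene _) (hd2.intervene _) hT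
  simp only [SkelAdj, intervene, Set.mem_singleton_iff] at hs hI
  have hp : p ≠ x := fun h => hd1.irrefl x (h ▸ hpx)
  have hnp := hd1.asymm hpx
  have h1 := hs p x
  have h2 := hI p x
  have hmem : (E2 p x ∧ x ∈ I2) ∨ (E2 x p ∧ p ∈ I2) := by tauto
  rcases hmem with ⟨-, hx⟩ | ⟨hxp, hpI⟩
  · obtain rfl := hI2.eq_singleton_of_mem hx
    refine .inl fun q => ?_
    have h3 := hs q x
    have h4 := hI q x
    have h5 := @IsDAG.asymm _ _ hd1 q x
    have h6 := @IsDAG.asymm _ _ hd2 q x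
    have h7 := hd1.irrefl x
    have h8 := hd2.irrefl x
    grind
  · obtain rfl := hI2.eq_singleton_of_mem hpI
    simp only [Set.mem_singleton_iff] at hI
    refine .inr ⟨hxp, fun q hq => ?_, fun q hq => ?_⟩
    · have h3 := hs q p
      have h4 := hI q p
      have h5 := @IsDAG.asymm _ _ hd2 q p hq
      grind
    · have h3 := hs q x
      have h4 := hI q x
      have h5 := @IsDAG.asymm _ _ hd1 q x hq
      have h6 : x ≠ p := hp.symm
      grind

/-- If some edge is oriented differently in `E2`, then one such edge is isolated in `E1`. -/
theorem ParentsMatchOrSwap.exists_isolatedEdge {V : Type u} [Finite V] {E1 E2 : V → V → Prop}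
    (hd1 : IsDAG E1) (hd2 : IsDAG E2) (hm : ParentsMatchOrSwap E1 E2)
    (h : ∃ p x, E1 p x ∧ ¬ E2 p x) :
    ∃ p x, IsolatedEdge E1 p x ∧ E2 x p ∧ ∀ q, E2 q p → q = x := by
  have : Std.Irrefl (Relation.TransGen E1) := ⟨hd1⟩
  have hwf : WellFounded (Relation.TransGen E1) :=
    Finite.wellFounded_of_trans_of_irrefl _
  obtain ⟨p, ⟨x, hpx, hpx'⟩, hmin⟩ := hwf.has_min {p | ∃ x, E1 p x ∧ ¬ E2 p x} h
  rcases hm p x hpx with h | ⟨hxp, hp, hx⟩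
  · exact (hpx' ((h p).2 hpx)).elim
  refine ⟨p, x, ⟨hpx, fun q hq => ?_, hx⟩, hxp, hp⟩
  rcases hm q p hq with h | ⟨hpq, -, -⟩
  · exact hd1.asymm hpx ((h x).1 hxp)
  · exact hmin q ⟨p, hq, hd2.asymm hpq⟩ (.single hq)

theorem ParentsMatchOrSwap.isoEquiv {V : Type u} [Finite V] {E1 E2 : V → V → Prop}
    (hd1 : IsDAG E1) (hd2 : IsDAG E2) (hs : ∀ a b, SkelAdj E1 a b ↔ SkelAdj E2 a b)
    (hm : ParentsMatchOrSwap E1 E2) : IsoEquiv E1 E2 := by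
  induction hn : {e : V × V | E1 e.1 e.2 ∧ ¬ E2 e.1 e.2}.ncard using Nat.strong_induction_on
    generalizing E1 with
  | _ n ih =>
    by_cases hdiff : ∃ p x, E1 p x ∧ ¬ E2 p x
    · obtain ⟨p, x, hiso, hxp, hp2⟩ := hm.exists_isolatedEdge hd1 hd2 hdiff
      have hd := hd1.reverseEdge hiso
      have hpx2 := hd2.asymm hxp
      refine .head ⟨hd1, hd, p, x, hiso, rfl⟩ (ih _ ?_ hd ?_ ?_ rfl)
      · rw [← hn]
        refine Set.ncard_lt_ncard ⟨?_, fun h => ?_⟩ (Set.toFinite _)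
        · rintro ⟨a, b⟩ ⟨⟨h, -⟩ | ⟨rfl, rfl⟩, h'⟩
          · exact ⟨h, h'⟩
          · exact (h' hxp).elim
        · rcases (h (show (p, x) ∈ _ from ⟨hiso.1, hpx2⟩)).1 with h | h
          · exact h.2 ⟨rfl, rfl⟩
          · obtain rfl : p = x := h.1
            exact hpx2 hxp
      · intro a b
        rw [← hs]
        have := hiso.1
        simp only [SkelAdj, reverseEdge]
        by_cases h1 : a = p ∧ b = x
        · obtain ⟨rfl, rfl⟩ := h1
          tauto
        by_cases h2 : a = x ∧ b = p
        · obtain ⟨rfl, rfl⟩ := h2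
          tauto
        tauto
      · obtain ⟨hpx, hp, hx⟩ := hiso
        have hne : p ≠ x := fun h => hp p (h ▸ hpx)
        rintro a b (⟨hab, hab'⟩ | ⟨rfl, rfl⟩)
        · have hbx : b ≠ x := by
            rintro rfl
            exact hab' ⟨hx _ hab, rfl⟩
          have hbp : b ≠ p := by
            rintro rfl
            exact hp _ hab
          simpa [reverseEdge, hbx, hbp] using hm a b hab
        · refine .inl fun q => ⟨fun h => .inr ⟨hp2 q h, rfl⟩, ?_⟩
          rintro (⟨h, -⟩ | ⟨rfl, -⟩)
          · exact (hp _ h).elim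
          · exact hxp
    · push Not at hdiff
      have : E1 = E2 := by
        ext a b
        refine ⟨hdiff a b, fun h => ?_⟩
        rcases (hs a b).2 (.inl h) with h' | h'
        · exact h'
        · exact (hd2.asymm h (hdiff b a h')).elim
      subst this
      exact .refl

/-- Markov equivalent DAGs that are not isolated equivalent can be
distinguished: there is a single-node hard intervention target `I1` such that no
single-node hard intervention target `I2` yields the same d-separation structure. -/
theorem statement3 {V : Type u} [Fintype V] (E1 E2 : V → V → Prop)
    (hd1 : IsDAG E1) (hd2 : IsDAG E2)
    (hmeq : Tsep E1 = Tsep E2) (hniso : ¬ IsoEquiv E1 E2) :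
    ∃ I1 : Set V, I1.Subsingleton ∧
      ∀ I2 : Set V, I2.Subsingleton →
        Tsep (intervene E1 I1) ≠ Tsep (intervene E2 I2) := by
  by_contra! h
  have hs := skelAdj_iff_of_Tsep_eq hd1 hd2 hmeq
  exact hniso ((parentsMatchOrSwap_of_intervene hd1 hd2 hs h).isoEquiv hd1 hd2 hs)
end

section
/- Let G be a DAG and I a single-node hard intervention target. Then every d-separation triple of G is a d-separation triple of G^(I): 𝒯(G) ⊆ 𝒯(G^(I)). -/
universe u

/-- An edge of an acyclic graph cannot be reversed, so an adjacency surviving an intervention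
keeps its orientation. -/
theorem intervene_of_adj {V : Type u} {E : V → V → Prop} (hd : IsDAG E) {I : Set V} {u v : V}
    (hadj : intervene E I u v ∨ intervene E I v u) (huv : E u v) : intervene E I u v :=
  hadj.resolve_right fun hvu => hd u (.tail (.single huv) hvu.1)

/-- Activity of a triple in the intervened graph implies activity in the original one. -/
theorem ActiveTriple.of_intervene {V : Type u} {E : V → V → Prop} (hd : IsDAG E) {I C : Set V}
    {u v w : V} (huv : intervene E I u v ∨ intervene E I v u)
    (hvw : intervene E I v w ∨ intervene E I w v)
    (h : ActiveTriple (intervene E I) C u v w) : ActiveTriple E C u v w := by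
  refine ⟨fun ⟨hu, hw⟩ => ?_, fun hn => h.2 fun ⟨hu, hw⟩ => hn ⟨hu.1, hw.1⟩⟩
  obtain ⟨d, hvd, hdC⟩ := h.1 ⟨intervene_of_adj hd huv hu, intervene_of_adj hd hvw.symm hw⟩
  exact ⟨d, Relation.ReflTransGen.mono (fun _ _ hab => hab.1) _ _ hvd, hdC⟩

theorem TriplesActive.of_intervene {V : Type u} {E : V → V → Prop} (hd : IsDAG E) {I C : Set V} :
    ∀ {p : List V}, p.IsChain (fun u v => intervene E I u v ∨ intervene E I v u) →
      TriplesActive (intervene E I) C p → TriplesActive E C p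
  | [], _, _ => trivial
  | [_], _, _ => trivial
  | [_, _], _, _ => trivial
  | _ :: _ :: _ :: _, .cons_cons huv hc@(.cons_cons hvw _), h =>
    ⟨h.1.of_intervene hd huv hvw, TriplesActive.of_intervene hd hc h.2⟩

/-- An active path of the intervened graph is active in the original graph. -/
theorem IsActivePath.of_intervene {V : Type u} {E : V → V → Prop} (hd : IsDAG E) {I C : Set V}
    {p : List V} {a b : V} (h : IsActivePath (intervene E I) C p a b) : IsActivePath E C p a b :=
  have ⟨hnodup, hhead, hlast, hchain, hactive⟩ := h
  ⟨hnodup, hhead, hlast, hchain.imp fun _ _ => Or.imp And.left And.left,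
    hactive.of_intervene hd hchain⟩

/-- Single-node hard interventions only create d-separations:
`𝒯(G) ⊆ 𝒯(G^(I))`. -/
theorem statement6 {V : Type u} [Fintype V] (E : V → V → Prop)
    (hd : IsDAG E) (I : Set V) (hI : I.Subsingleton) :
    Tsep E ⊆ Tsep (intervene E I) := by
  rintro t ⟨hAB, hAC, hBC, hsep⟩
  exact ⟨hAB, hAC, hBC, fun a ha b hb ⟨p, hp⟩ => hsep a ha b hb ⟨p, hp.of_intervene hd⟩⟩
end

section
/- Let G be a DAG and let A ≠ B be vertices that are d-connected given the empty set. Then there exists a vertex S (possibly equal to A or to B) together with a directed path from S to A and a directed path from S to B that meet only at S; in particular, either A and B share a common ancestor, or there is a directed path from one of A, B to the other. Moreover, it is impossible that G contains both a directed path from A to B and a directed path from B to A, so all directed paths between A and B (if any) point in the same direction. -/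
universe u

/-- A path that is active given `∅` has no collider, so it first runs against the edges up to
some vertex `S` and then along the edges. -/
lemma exists_source_split {V : Type u} {E : V → V → Prop} :
    ∀ {p : List V}, p ≠ [] → List.IsChain (fun u v => E u v ∨ E v u) p → TriplesActive E ∅ p →
      ∃ (l : List V) (S : V) (r : List V), p = l ++ S :: r ∧
        List.IsChain (fun u v => E v u) (l ++ [S]) ∧ List.IsChain E (S :: r)
  | [], h, _, _ => absurd rfl h
  | [x], _, _, _ => ⟨[], x, [], by simp⟩
  | x :: y :: t, _, hc, ht => by
    obtain ⟨hxy, hc'⟩ := List.isChain_cons_cons.mp hc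
    have ht' : TriplesActive E ∅ (y :: t) := by
      cases t with
      | nil => trivial
      | cons z t => exact ht.2
    obtain ⟨l, S, r, hp, hl, hr⟩ := exists_source_split (List.cons_ne_nil y t) hc' ht'
    cases l with
    | nil =>
      obtain ⟨rfl, rfl⟩ := List.cons.inj hp
      rcases hxy with hxy | hyx
      · exact ⟨[], x, y :: t, rfl, by simp, List.isChain_cons_cons.mpr ⟨hxy, hr⟩⟩
      · exact ⟨[x], y, t, rfl, by simpa using hyx, hr⟩
    | cons y' l =>
      obtain ⟨rfl, rfl⟩ := List.cons.inj hp
      rcases hxy with hxy | hyx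
      · exfalso
        cases l <;>
        · obtain ⟨d, -, hd⟩ := ht.1.1 ⟨hxy, (List.isChain_cons_cons.mp hl).1⟩
          exact hd
      · exact ⟨x :: y :: l, S, r, rfl, List.isChain_cons_cons.mpr ⟨hyx, hl⟩, hr⟩

lemma IsDirPath.reflTransGen {V : Type u} {E : V → V → Prop} {p : List V} {a b : V}
    (h : IsDirPath E p a b) : Relation.ReflTransGen E a b := by
  obtain ⟨-, ha, hb, hc⟩ := h
  induction p generalizing a with
  | nil => simp at ha
  | cons x t ih =>
    obtain rfl : x = a := by simpa using ha
    cases t with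
    | nil =>
      obtain rfl : x = b := by simpa using hb
      exact .refl
    | cons y t =>
      obtain ⟨hxy, hc⟩ := List.isChain_cons_cons.mp hc
      exact .head hxy (ih rfl (by simpa using hb) hc)

/-- If distinct vertices `A` and `B` of a DAG are d-connected given the
empty set, then there is a vertex `S` with directed paths from `S` to `A` and from `S` to
`B` meeting only at `S`; in particular `A` and `B` share a common ancestor or one is
reachable from the other by a directed path; moreover it is impossible that there are
directed paths both from `A` to `B` and from `B` to `A`. -/
theorem statement7 {V : Type u} [Fintype V] (E : V → V → Prop)
    (hd : IsDAG E) (A B : V) (hne : A ≠ B) (hconn : dconn E ∅ A B) :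
    (∃ (S : V) (p1 p2 : List V), IsDirPath E p1 S A ∧ IsDirPath E p2 S B ∧
        ∀ w : V, w ∈ p1 → w ∈ p2 → w = S) ∧
    ((∃ S : V, Relation.TransGen E S A ∧ Relation.TransGen E S B) ∨
        Relation.TransGen E A B ∨ Relation.TransGen E B A) ∧
    ¬ (Relation.TransGen E A B ∧ Relation.TransGen E B A) := by
  have hpaths : ∃ (S : V) (p1 p2 : List V), IsDirPath E p1 S A ∧ IsDirPath E p2 S B ∧
      ∀ w : V, w ∈ p1 → w ∈ p2 → w = S := by
    obtain ⟨p, hnd, hA, hB, hc, ht⟩ := hconn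
    have hp : p ≠ [] := by
      rintro rfl
      simp at hA
    obtain ⟨l, S, r, rfl, hl, hr⟩ := exists_source_split hp hc ht
    have hnd' := hnd
    simp only [List.nodup_append, List.nodup_cons] at hnd'
    obtain ⟨-, -, hdisj⟩ := hnd'
    refine ⟨S, (l ++ [S]).reverse, S :: r, ⟨?_, by simp, ?_, ?_⟩, ⟨?_, rfl, ?_, hr⟩, ?_⟩
    · rw [List.nodup_reverse]
      exact hnd.sublist (by simp)
    · rw [List.getLast?_reverse]
      cases l <;> simpa using hA
    · exact List.isChain_reverse.mpr hl
    · exact hnd.sublist (by simp)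
    · simpa [List.getLast?_append] using hB
    · intro w hw1 hw2
      simp only [List.mem_reverse, List.mem_append, List.mem_singleton] at hw1
      exact hw1.elim (fun hw => absurd rfl (hdisj w hw w hw2)) id
  refine ⟨hpaths, ?_, fun h => hd A (h.1.trans h.2)⟩
  obtain ⟨S, p1, p2, h1, h2, -⟩ := hpaths
  rcases Relation.reflTransGen_iff_eq_or_transGen.mp h1.reflTransGen with rfl | hSA
  · rcases Relation.reflTransGen_iff_eq_or_transGen.mp h2.reflTransGen with rfl | hAB
    · exact absurd rfl hne
    · exact .inr (.inl hAB)
  · rcases Relation.reflTransGen_iff_eq_or_transGen.mp h2.reflTransGen with rfl | hSB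
    · exact .inr (.inr hSA)
    · exact .inl ⟨S, hSA, hSB⟩
end

section
/- Let G be a DAG and let A ≠ B be vertices. Then there exists I ∈ {∅, {A}, {B}} such that A and B are d-separated given the empty set in G^(I). -/
universe u

/-- With nothing conditioned on, no interior vertex of an active path is a collider. -/
lemma ActiveTriple.not_collider {V : Type u} {E : V → V → Prop} {u v w : V}
    (h : ActiveTriple E ∅ u v w) : ¬ (E u v ∧ E w v) := fun hc => by
  obtain ⟨_, _, hd⟩ := h.1 hc
  exact hd

/-- A collider-free path whose first edge points forward is directed. -/
lemma transGen_of_triplesActive {V : Type u} {E : V → V → Prop} {b : V} :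
    ∀ (l : List V) (u v : V), E u v → (u :: v :: l).getLast? = some b →
      List.IsChain (fun x y => E x y ∨ E y x) (u :: v :: l) →
      TriplesActive E ∅ (u :: v :: l) → Relation.TransGen E u b
  | [], u, v, huv, hb, _, _ => by
    obtain rfl : v = b := by simpa using hb
    exact .single huv
  | w :: l, u, v, huv, hb, hc, ht => by
    have hc' := (List.isChain_cons_cons.1 hc).2
    have hvw : E v w := (List.isChain_cons_cons.1 hc').1.resolve_right
      fun h => ht.1.not_collider ⟨huv, h⟩
    exact .head huv (transGen_of_triplesActive l v w hvw
      (by simpa [List.getLast?_cons_cons] using hb) hc' ht.2)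

/-- A collider-free path ending at a parentless vertex is directed away from that vertex. -/
lemma transGen_of_triplesActive_of_last {V : Type u} {E : V → V → Prop} {b : V}
    (hpar : ∀ x, ¬ E x b) :
    ∀ (l : List V) (u v : V), (u :: v :: l).getLast? = some b →
      List.IsChain (fun x y => E x y ∨ E y x) (u :: v :: l) →
      TriplesActive E ∅ (u :: v :: l) → E v u ∧ Relation.TransGen E b u
  | [], u, v, hb, hc, _ => by
    obtain rfl : v = b := by simpa using hb
    have h := (List.isChain_cons_cons.1 hc).1.resolve_left (hpar u)
    exact ⟨h, .single h⟩
  | w :: l, u, v, hb, hc, ht => by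
    have hc' := List.isChain_cons_cons.1 hc
    obtain ⟨hwv, hbv⟩ := transGen_of_triplesActive_of_last hpar l v w
      (by simpa [List.getLast?_cons_cons] using hb) hc'.2 ht.2
    have h : E v u := hc'.1.resolve_left fun h => ht.1.not_collider ⟨h, hwv⟩
    exact ⟨h, hbv.tail h⟩

/-- A path between distinct vertices has at least one edge. -/
lemma IsActivePath.exists_eq_cons_cons {V : Type u} {E : V → V → Prop} {C : Set V}
    {p : List V} {a b : V} (h : IsActivePath E C p a b) (hne : a ≠ b) :
    ∃ v l, p = a :: v :: l := by
  obtain ⟨-, ha, hb, -, -⟩ := h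
  match p with
  | [] => simp at ha
  | [x] => simp_all
  | x :: v :: l => exact ⟨v, l, by simp_all⟩

lemma transGen_of_dconn_of_parentless_left {V : Type u} {E : V → V → Prop} {a b : V}
    (hpar : ∀ x, ¬ E x a) (hne : a ≠ b) (h : dconn E ∅ a b) : Relation.TransGen E a b := by
  obtain ⟨p, hp⟩ := h
  obtain ⟨v, l, rfl⟩ := hp.exists_eq_cons_cons hne
  obtain ⟨-, -, hb, hc, ht⟩ := hp
  exact transGen_of_triplesActive l a v
    ((List.isChain_cons_cons.1 hc).1.resolve_right (hpar v)) hb hc ht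

lemma transGen_of_dconn_of_parentless_right {V : Type u} {E : V → V → Prop} {a b : V}
    (hpar : ∀ x, ¬ E x b) (hne : a ≠ b) (h : dconn E ∅ a b) : Relation.TransGen E b a := by
  obtain ⟨p, hp⟩ := h
  obtain ⟨v, l, rfl⟩ := hp.exists_eq_cons_cons hne
  obtain ⟨-, -, hb, hc, ht⟩ := hp
  exact (transGen_of_triplesActive_of_last hpar l a v hb hc ht).2

/-- For any two distinct vertices `A ≠ B` of a DAG, one of the
intervention targets `∅`, `{A}`, `{B}` d-separates `A` and `B` given the empty set. -/
theorem statement8 {V : Type u} [Fintype V] (E : V → V → Prop)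
    (hd : IsDAG E) (A B : V) (hne : A ≠ B) :
    ∃ I ∈ ({∅, {A}, {B}} : Set (Set V)), dsepV (intervene E I) ∅ A B := by
  have hpar (v x : V) : ¬ intervene E {v} x v := fun h => h.2 rfl
  by_contra! hcon
  have hA : dconn (intervene E {A}) ∅ A B := not_not.1 (hcon {A} (by simp))
  have hB : dconn (intervene E {B}) ∅ A B := not_not.1 (hcon {B} (by simp))
  have hAB : Relation.TransGen E A B :=
    Relation.TransGen.mono (fun _ _ h => h.1) _ _
      (transGen_of_dconn_of_parentless_left (hpar A) hne hA)
  have hBA : Relation.TransGen E B A :=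
    Relation.TransGen.mono (fun _ _ h => h.1) _ _
      (transGen_of_dconn_of_parentless_right (hpar B) hne hB)
  exact hd A (hAB.trans hBA)
end

section
/- Let G be a measurement model that is graphically maximal and satisfies graphical condition (c), with 𝓘 the complete family of intervention targets. Then for every hidden vertex h, the child set ch(h) is a maximal valid subset. -/
universe u

lemma IsDAG.mono {V : Type u} {E F : V → V → Prop} (hE : IsDAG E) (h : ∀ u v, F u v → E u v) :
    IsDAG F :=
  fun v hv => hE v (Relation.TransGen.mono h _ _ hv)

lemma IsDAG.asymm_s11 {V : Type u} {E : V → V → Prop} (hE : IsDAG E) {u v : V} (huv : E u v) :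
    ¬ E v u :=
  fun hvu => hE u (.tail (.single huv) hvu)

lemma triplesActive_empty_cons {V : Type u} {E : V → V → Prop} (hE : IsDAG E) {u v : V}
    {l : List V} (h : TriplesActive E ∅ (v :: l))
    (huv : E v u ∨ ∀ w ∈ l.head?, E v w) : TriplesActive E ∅ (u :: v :: l) := by
  cases l with
  | nil => trivial
  | cons w l =>
    refine ⟨⟨fun hcol => ?_, fun _ => Set.notMem_empty v⟩, h⟩
    rcases huv with huv | huv
    · exact absurd hcol.1 (hE.asymm_s11 huv)
    · exact absurd hcol.2 (hE.asymm_s11 (huv w rfl))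

lemma triplesActive_of_isChain {V : Type u} {E : V → V → Prop} (hE : IsDAG E) :
    ∀ {l : List V}, l.IsChain E → TriplesActive E ∅ l
  | [], _ => trivial
  | [_], _ => trivial
  | _ :: _ :: _, h => by
    rw [List.isChain_cons_cons] at h
    exact triplesActive_empty_cons hE (triplesActive_of_isChain hE h.2)
      (.inr (List.isChain_cons.1 h.2).1)

lemma nodup_of_isChain {V : Type u} {E : V → V → Prop} (hE : IsDAG E) {l : List V}
    (h : l.IsChain E) : l.Nodup := by
  have h' : l.IsChain (Relation.TransGen E) := h.imp fun _ _ => .single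
  refine h'.pairwise.imp ?_
  rintro a b hab rfl
  exact hE a hab

/-- Prepending the reversal of a directed path to an active path starting at a parent of the
first vertex of the directed path. -/
lemma active_reverse_append {V : Type u} {E : V → V → Prop} (hE : IsDAG E) :
    ∀ (l : List V) (y : V) (acc : List V), (y :: l).IsChain E →
      (y :: acc).IsChain (fun u v => E u v ∨ E v u) → TriplesActive E ∅ (y :: acc) →
      (l.reverse ++ y :: acc).IsChain (fun u v => E u v ∨ E v u) ∧
        TriplesActive E ∅ (l.reverse ++ y :: acc)
  | [], _, _, _, hc, ht => ⟨hc, ht⟩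
  | x :: l, y, acc, hl, hc, ht => by
    rw [List.isChain_cons_cons] at hl
    simpa using active_reverse_append hE l x (y :: acc) hl.2
      (List.isChain_cons_cons.2 ⟨.inr hl.1, hc⟩) (triplesActive_empty_cons hE ht (.inl hl.1))

lemma exists_directed_path {V : Type u} {E : V → V → Prop} {a b : V}
    (h : Relation.ReflTransGen E a b) :
    ∃ l : List V, (a :: l).IsChain E ∧ (a :: l).getLast? = some b ∧
      ∀ v ∈ a :: l, Relation.ReflTransGen E a v ∧ Relation.ReflTransGen E v b := by
  induction h using Relation.ReflTransGen.head_induction_on with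
  | refl => exact ⟨[], by simp, by simp, by simp [Relation.ReflTransGen.refl]⟩
  | head hac hcb ih =>
    rename_i a c
    obtain ⟨l, hl, hlast, hmem⟩ := ih
    refine ⟨c :: l, List.isChain_cons_cons.2 ⟨hac, hl⟩, by simpa using hlast, fun v hv => ?_⟩
    rcases List.mem_cons.1 hv with rfl | hv
    · exact ⟨.refl, .head hac hcb⟩
    · exact ⟨.head hac (hmem v hv).1, (hmem v hv).2⟩

lemma dconn_empty_of_common_ancestor {V : Type u} {E : V → V → Prop} (hE : IsDAG E) {a b c : V}
    (hca : Relation.ReflTransGen E c a) (hcb : Relation.ReflTransGen E c b) : dconn E ∅ a b := by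
  induction hca using Relation.ReflTransGen.head_induction_on with
  | refl =>
    obtain ⟨l, hl, hlast, -⟩ := exists_directed_path hcb
    exact ⟨a :: l, nodup_of_isChain hE hl, rfl, hlast, hl.imp fun _ _ => .inl,
      triplesActive_of_isChain hE hl⟩
  | head hcd hda ih =>
    rename_i c d
    by_cases hdb : Relation.ReflTransGen E d b
    · exact ih hdb
    obtain ⟨p, hp, hplast, hpmem⟩ := exists_directed_path hda
    obtain ⟨q, hq, hqlast, hqmem⟩ := exists_directed_path hcb
    obtain ⟨hchain, hact⟩ := active_reverse_append hE (d :: p) c q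
      (List.isChain_cons_cons.2 ⟨hcd, hp⟩) (hq.imp fun _ _ => .inl)
      (triplesActive_of_isChain hE hq)
    refine ⟨(d :: p).reverse ++ c :: q, ?_, ?_, ?_, hchain, hact⟩
    · refine List.nodup_append'.2 ⟨List.nodup_reverse.2 (nodup_of_isChain hE hp),
        nodup_of_isChain hE hq, fun v hv hv' => hdb ?_⟩
      exact (hpmem v (List.mem_reverse.1 hv)).1.trans (hqmem v hv').2
    · rw [List.head?_append, List.head?_reverse, hplast]
      rfl
    · rw [List.getLast?_append, hqlast]
      rfl

lemma reflTransGen_of_active {V : Type u} {E : V → V → Prop} {b : V} :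
    ∀ (l : List V) (a v : V), E a v → (v :: l).IsChain (fun u v => E u v ∨ E v u) →
      TriplesActive E ∅ (a :: v :: l) → (v :: l).getLast? = some b → Relation.ReflTransGen E a b
  | [], a, v, hav, _, _, hlast => by
    obtain rfl : v = b := by simpa using hlast
    exact .single hav
  | w :: l, a, v, hav, hc, ht, hlast => by
    rw [List.isChain_cons_cons] at hc
    have hwv : ¬ E w v := fun hwv => by simpa using ht.1.1 ⟨hav, hwv⟩
    exact .head hav (reflTransGen_of_active l v w (hc.1.resolve_right hwv) hc.2 ht.2
      (by simpa using hlast))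

lemma common_ancestor_of_active {V : Type u} {E : V → V → Prop} {b : V} :
    ∀ (l : List V) (a : V), (a :: l).IsChain (fun u v => E u v ∨ E v u) →
      TriplesActive E ∅ (a :: l) → (a :: l).getLast? = some b →
      ∃ c, Relation.ReflTransGen E c a ∧ Relation.ReflTransGen E c b
  | [], a, _, _, hlast => by
    obtain rfl : a = b := by simpa using hlast
    exact ⟨a, .refl, .refl⟩
  | v :: l, a, hc, ht, hlast => by
    rw [List.isChain_cons_cons] at hc
    have hlast' : (v :: l).getLast? = some b := by simpa using hlast
    rcases hc.1 with hav | hva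
    · exact ⟨a, .refl, reflTransGen_of_active l a v hav hc.2 ht hlast'⟩
    · have ht' : TriplesActive E ∅ (v :: l) := by
        cases l with
        | nil => trivial
        | cons w l => exact ht.2
      obtain ⟨c, hcv, hcb⟩ := common_ancestor_of_active l v hc.2 ht' hlast'
      exact ⟨c, hcv.tail hva, hcb⟩

/-- Two vertices of a DAG are d-connected given the empty set iff they have a common ancestor. -/
lemma dconn_empty_iff {V : Type u} {E : V → V → Prop} (hE : IsDAG E) {a b : V} :
    dconn E ∅ a b ↔ ∃ c, Relation.ReflTransGen E c a ∧ Relation.ReflTransGen E c b := by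
  refine ⟨?_, fun ⟨c, hca, hcb⟩ => dconn_empty_of_common_ancestor hE hca hcb⟩
  rintro ⟨_ | ⟨v, l⟩, -, hhead, hlast, hc, ht⟩
  · simp at hhead
  · obtain rfl : v = a := by simpa using hhead
    exact common_ancestor_of_active l v hc ht hlast

lemma dconn_empty_symm {V : Type u} {E : V → V → Prop} (hE : IsDAG E) {a b : V}
    (h : dconn E ∅ a b) : dconn E ∅ b a := by
  obtain ⟨c, hca, hcb⟩ := (dconn_empty_iff hE).1 h
  exact (dconn_empty_iff hE).2 ⟨c, hcb, hca⟩

lemma eq_of_reflTransGen_of_sink {V : Type u} {E : V → V → Prop} {x v : V}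
    (hx : ∀ w, ¬ E x w) (h : Relation.ReflTransGen E x v) : v = x := by
  rcases h.cases_head with rfl | ⟨w, hw, -⟩
  · rfl
  · exact absurd hw (hx w)

lemma reflTransGen_addEdge {V : Type u} {E : V → V → Prop} {h x c v : V}
    (hx : ∀ w, ¬ E x w) (hhx : h ≠ x) (hcv : Relation.ReflTransGen (addEdge E h x) c v) :
    Relation.ReflTransGen E c v ∨ (v = x ∧ Relation.ReflTransGen E c h) := by
  induction hcv with
  | refl => exact .inl .refl
  | tail _ hbv ih =>
    rcases hbv with hbv | ⟨rfl, rfl⟩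
    · rcases ih with ih | ⟨rfl, -⟩
      · exact .inl (ih.tail hbv)
      · exact absurd hbv (hx _)
    · rcases ih with ih | ⟨hb, -⟩
      · exact .inr ⟨rfl, ih⟩
      · exact absurd hb hhx

lemma isDAG_addEdge {V : Type u} {E : V → V → Prop} (hE : IsDAG E) {h x : V}
    (hx : ∀ w, ¬ E x w) (hhx : h ≠ x) : IsDAG (addEdge E h x) := by
  intro v hv
  have hsink : ∀ w, ¬ addEdge E h x x w := fun w hw => hw.elim (hx w) fun hw => hhx hw.1.symm
  obtain ⟨w, hvw, hwv⟩ := Relation.TransGen.head'_iff.1 hv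
  rcases reflTransGen_addEdge hx hhx hwv with hwv' | ⟨rfl, -⟩
  · rcases hvw with hvw | ⟨rfl, rfl⟩
    · exact hE v (Relation.TransGen.head'_iff.2 ⟨w, hvw, hwv'⟩)
    · exact hhx (eq_of_reflTransGen_of_sink hx hwv')
  · exact hsink w hvw

/-- A pair d-connected only after adding an edge into a sink `x` consists of `x` and a vertex
that is d-connected to the tail of the new edge. -/
lemma dconn_addEdge {V : Type u} {E : V → V → Prop} (hE : IsDAG E) {h x a b : V}
    (hx : ∀ w, ¬ E x w) (hhx : h ≠ x) (hab : a ≠ b) (hconn : dconn (addEdge E h x) ∅ a b)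
    (hsep : ¬ dconn E ∅ a b) : (a = x ∧ dconn E ∅ h b) ∨ (b = x ∧ dconn E ∅ h a) := by
  obtain ⟨c, hca, hcb⟩ := (dconn_empty_iff (isDAG_addEdge hE hx hhx)).1 hconn
  rcases reflTransGen_addEdge hx hhx hca with hca' | ⟨rfl, hca'⟩ <;>
  rcases reflTransGen_addEdge hx hhx hcb with hcb' | ⟨rfl, hcb'⟩
  · exact absurd ((dconn_empty_iff hE).2 ⟨c, hca', hcb'⟩) hsep
  · exact .inr ⟨rfl, (dconn_empty_iff hE).2 ⟨c, hcb', hca'⟩⟩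
  · exact .inl ⟨rfl, (dconn_empty_iff hE).2 ⟨c, hca', hcb'⟩⟩
  · exact absurd rfl hab

lemma exists_of_UDG_addEdge_ne {V : Type u} {E : V → V → Prop} {Xs : Set V} (hE : IsDAG E)
    {h x : V} (hx : ∀ w, ¬ E x w) (hhx : h ≠ x) (hne : UDG (addEdge E h x) Xs ≠ UDG E Xs) :
    ∃ y ∈ Xs, x ≠ y ∧ dconn E ∅ h y ∧ ¬ dconn E ∅ x y := by
  by_contra! hcon
  refine hne (funext₂ fun a b => propext ?_)
  refine ⟨fun ⟨ha, hb, hab, hconn⟩ => ⟨ha, hb, hab, ?_⟩,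
    fun ⟨ha, hb, hab, hconn⟩ => ⟨ha, hb, hab, ?_⟩⟩
  · by_contra hsep
    rcases dconn_addEdge hE hx hhx hab hconn hsep with ⟨rfl, hy⟩ | ⟨rfl, hy⟩
    · exact hsep (hcon b hb hab hy)
    · exact hsep (dconn_empty_symm hE (hcon a ha hab.symm hy))
  · obtain ⟨c, hca, hcb⟩ := (dconn_empty_iff hE).1 hconn
    exact (dconn_empty_iff (isDAG_addEdge hE hx hhx)).2
      ⟨c, Relation.ReflTransGen.mono (fun _ _ => .inl) _ _ hca,
        Relation.ReflTransGen.mono (fun _ _ => .inl) _ _ hcb⟩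

lemma intervene_addEdge {V : Type u} {E : V → V → Prop} {I : Set V} {h x : V} (hx : x ∉ I) :
    intervene (addEdge E h x) I = addEdge (intervene E I) h x := by
  funext u v
  simp only [intervene, addEdge, eq_iff_iff]
  constructor
  · rintro ⟨huv | huv, hv⟩
    · exact .inl ⟨huv, hv⟩
    · exact .inr huv
  · rintro (huv | ⟨rfl, rfl⟩)
    · exact ⟨.inl huv.1, huv.2⟩
    · exact ⟨.inr ⟨rfl, rfl⟩, hx⟩

lemma exists_isMaxCliqueIn {V : Type u} [Finite V] {R : V → V → Prop} {Xs C : Set V}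
    (hC : IsCliqueIn R Xs C) : ∃ D, IsMaxCliqueIn R Xs D ∧ C ⊆ D := by
  obtain ⟨D, hCD, hD⟩ := (Set.toFinite {C | IsCliqueIn R Xs C}).exists_le_maximal hC
  exact ⟨D, ⟨hD.prop, fun C' hC' hDC' => hD.eq_of_le hC' hDC'⟩, hCD⟩

lemma notMem_of_mem_completeFamily {V : Type u} {Xs Hs I : Set V} (hdisj : Disjoint Xs Hs)
    (hI : I ∈ completeFamily Hs) {x : V} (hx : x ∈ Xs) : x ∉ I := by
  rcases hI with rfl | ⟨h, hh, rfl⟩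
  · simp
  · rintro rfl
    exact hdisj.notMem_of_mem_left hx hh

lemma isCliqueIn_chSet {V : Type u} {E : V → V → Prop} {Xs : Set V} (hE : IsDAG E) (h : V) :
    IsCliqueIn (UDG E Xs) Xs (chSet E Xs h) :=
  ⟨fun _ hx => hx.1, fun _ hx _ hy hxy =>
    ⟨hx.1, hy.1, hxy, (dconn_empty_iff hE).2 ⟨h, .single hx.2, .single hy.2⟩⟩⟩

lemma isCliqueIn_insert_chSet {V : Type u} {E : V → V → Prop} {Xs : Set V} (hE : IsDAG E)
    {h y : V} (hy : y ∈ Xs) (hhy : dconn E ∅ h y) :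
    IsCliqueIn (UDG E Xs) Xs (insert y (chSet E Xs h)) := by
  obtain ⟨c, hch, hcy⟩ := (dconn_empty_iff hE).1 hhy
  refine ⟨Set.insert_subset hy fun _ hx => hx.1, ?_⟩
  rintro a (rfl | ha) b (rfl | hb) hab
  · exact absurd rfl hab
  · exact ⟨hy, hb.1, hab, (dconn_empty_iff hE).2 ⟨c, hcy, hch.tail hb.2⟩⟩
  · exact ⟨ha.1, hy, hab, (dconn_empty_iff hE).2 ⟨c, hch.tail ha.2, hcy⟩⟩
  · exact (isCliqueIn_chSet hE h).2 a ha b hb hab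

lemma chSet_intervene {V : Type u} {E : V → V → Prop} {Xs Hs I : Set V} (hdisj : Disjoint Xs Hs)
    (hI : I ∈ completeFamily Hs) (h : V) : chSet (intervene E I) Xs h = chSet E Xs h := by
  ext x
  exact ⟨fun hx => ⟨hx.1, hx.2.1⟩,
    fun hx => ⟨hx.1, hx.2, notMem_of_mem_completeFamily hdisj hI hx.1⟩⟩

/-- In a graphically maximal measurement model satisfying condition
(c), with the complete family of intervention targets, the child set of every hidden
vertex is a maximal valid subset. -/
theorem statement11 {V : Type u} [Fintype V] (E : V → V → Prop) (Xs Hs : Set V)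
    (hmm : IsMeasurementModel E Xs Hs)
    (hmax : GraphMaximal E Xs Hs) (hc : CondC E Xs Hs) :
    ∀ h ∈ Hs, MaxValidSubset E Xs Hs (chSet E Xs h) := by
  obtain ⟨hdag, hdisj, hedge⟩ := hmm
  have hdagI (I : Set V) : IsDAG (intervene E I) := hdag.mono fun _ _ huv => huv.1
  intro h hh
  refine ⟨⟨fun _ hx => hx.1, fun I hI => ?_⟩, ?_⟩
  · rw [← chSet_intervene hdisj hI h]
    exact exists_isMaxCliqueIn (isCliqueIn_chSet (hdagI I) h)
  · rintro ⟨X'', hvalid, hss, hΩ⟩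
    obtain ⟨x, hxX'', hxch⟩ := Set.exists_of_ssubset hss
    have hx : x ∈ Xs := hvalid.1 hxX''
    have hxH : x ∉ Hs := hdisj.notMem_of_mem_left hx
    have hhx : h ≠ x := fun heq => hxH (heq ▸ hh)
    obtain ⟨I, hI, hne⟩ := hmax.2 h hh x hx fun hE => hxch ⟨hx, hE⟩
    rw [intervene_addEdge (notMem_of_mem_completeFamily hdisj hI hx)] at hne
    obtain ⟨y, hy, hxy, hconn, hsep⟩ := exists_of_UDG_addEdge_ne (hdagI I)
      (fun w hw => hxH (hedge x w hw.1).1) hhx hne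
    obtain ⟨C, hC, hsub⟩ := exists_isMaxCliqueIn (isCliqueIn_insert_chSet (hdagI I) hy hconn)
    rw [chSet_intervene hdisj hI] at hsub
    have hxC : x ∈ C :=
      hΩ C (Set.mem_biUnion hI hC) ((Set.subset_insert _ _).trans hsub) hxX''
    exact hsep (hC.1.2 x hxC y (hsub (Set.mem_insert _ _)) hxy).2.2.2
end

section
/- Let G be a measurement model that is graphically maximal and satisfies graphical condition (c), with 𝓘 the complete family of intervention targets. If no maximal valid subset is both imaginary and non-replaceable, then for every subset X′ ⊆ X: X′ is a non-replaceable maximal valid subset if and only if there exists a hidden vertex h with ch(h) = X′. -/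
universe u

section

variable {V : Type u} {E : V → V → Prop} {Xs Hs : Set V}

/-- A path with no conditioning whose first edge points forward is directed. -/
theorem transGen_getLast_of_triplesActive_empty {R : V → V → Prop} {b : V} :
    ∀ (rest : List V) (u v : V), R u v → (v :: rest).getLast? = some b →
      List.IsChain (fun a c => R a c ∨ R c a) (v :: rest) →
      TriplesActive R ∅ (u :: v :: rest) → Relation.TransGen R u b
  | [], u, v, huv, hlast, _, _ => by
    simp only [List.getLast?_singleton, Option.some.injEq] at hlast
    exact hlast ▸ .single huv
  | w :: rest, u, v, huv, hlast, hchain, hact => by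
    rw [List.isChain_cons_cons] at hchain
    obtain ⟨htriple, hact⟩ := hact
    have hvw : R v w := hchain.1.resolve_right fun hwv => by
      obtain ⟨d, -, hd⟩ := htriple.1 ⟨huv, hwv⟩
      exact hd
    rw [List.getLast?_cons_cons] at hlast
    exact .head huv
      (transGen_getLast_of_triplesActive_empty rest v w hvw hlast hchain.2 hact)

/-- Under an intervention on `a`, only descendants of `a` are d-connected to `a`. -/
theorem transGen_of_dconn_intervene_singleton {a b : V} (hab : a ≠ b)
    (h : dconn (intervene E {a}) ∅ a b) : Relation.TransGen E a b := by
  obtain ⟨p, -, hhead, hlast, hchain, hact⟩ := h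
  match p, hhead, hlast, hchain, hact with
  | [c], hhead, hlast, _, _ =>
    simp only [List.head?_cons, List.getLast?_singleton, Option.some.injEq] at hhead hlast
    exact absurd (hhead.symm.trans hlast) hab
  | c :: d :: rest, hhead, hlast, hchain, hact =>
    simp only [List.head?_cons, Option.some.injEq] at hhead
    subst hhead
    have hchain' := List.isChain_cons_cons.1 hchain
    have hcd := hchain'.1.resolve_right fun hdc => hdc.2 rfl
    rw [List.getLast?_cons_cons] at hlast
    exact Relation.TransGen.mono (fun _ _ (hr : intervene E {c} _ _) => hr.1) _ _
      (transGen_getLast_of_triplesActive_empty rest c d hcd hlast hchain'.2 hact)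

/-- Observed vertices with a common parent are d-connected under every intervention on
hidden vertices. -/
theorem dconn_intervene_of_mem_chSet (hmm : IsMeasurementModel E Xs Hs) {I : Set V}
    (hI : I ⊆ Hs) {h x y : V} (hx : x ∈ chSet E Xs h) (hy : y ∈ chSet E Xs h) :
    dconn (intervene E I) ∅ x y := by
  have hdisj := Set.disjoint_left.1 hmm.2.1
  have hH : h ∈ Hs := (hmm.2.2 h x hx.2).1
  by_cases hxy : x = y
  · subst hxy
    exact ⟨[x], List.nodup_singleton x, rfl, rfl, List.isChain_singleton x, trivial⟩
  · have hxh : x ≠ h := fun e => hdisj hx.1 (e ▸ hH)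
    have hyh : h ≠ y := fun e => hdisj hy.1 (e ▸ hH)
    refine ⟨[x, h, y], by simp [hxy, hxh, hyh], rfl, rfl, ?_, ?_, trivial⟩
    · exact List.isChain_cons_cons.2 ⟨.inr ⟨hx.2, fun hi => hdisj hx.1 (hI hi)⟩,
        List.isChain_cons_cons.2 ⟨.inl ⟨hy.2, fun hi => hdisj hy.1 (hI hi)⟩,
          List.isChain_singleton _⟩⟩
    · exact ⟨fun hcol => absurd (hmm.2.2 x h hcol.1.1).1 (hdisj hx.1), fun _ => id⟩

theorem subset_of_mem_completeFamily {I : Set V} (hI : I ∈ completeFamily Hs) : I ⊆ Hs := by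
  rcases hI with rfl | ⟨h, hh, rfl⟩
  · exact Set.empty_subset _
  · exact Set.singleton_subset_iff.2 hh

theorem validSubset_chSet [Finite V] (hmm : IsMeasurementModel E Xs Hs) (h : V) :
    ValidSubset E Xs Hs (chSet E Xs h) := by
  refine ⟨fun x hx => hx.1, fun I hI => ?_⟩
  have hclique : IsCliqueIn (UDG (intervene E I) Xs) Xs (chSet E Xs h) :=
    ⟨fun x hx => hx.1, fun x hx y hy hxy => ⟨hx.1, hy.1, hxy,
      dconn_intervene_of_mem_chSet hmm (subset_of_mem_completeFamily hI) hx hy⟩⟩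
  obtain ⟨C, hle, hC⟩ :=
    (Set.toFinite {C | IsCliqueIn (UDG (intervene E I) Xs) Xs C}).exists_le_maximal hclique
  exact ⟨C, ⟨hC.prop, fun C' hC' hCC' => hC.eq_of_subset hC' hCC'⟩, hle⟩

theorem maxValidSubset_of_maximal {M : Set V} (hM : Maximal (ValidSubset E Xs Hs) M) :
    MaxValidSubset E Xs Hs M :=
  ⟨hM.prop, fun ⟨_, hN, hMN, _⟩ => hMN.2 (hM.le_of_ge hN hMN.1)⟩

theorem not_replaceableSubset_of_maximal {M : Set V}
    (hM : Maximal (ValidSubset E Xs Hs) M) : ¬ ReplaceableSubset E Xs Hs M :=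
  fun ⟨_, _, hN, hMN⟩ => hMN.2 (hM.le_of_ge hN.1 hMN.1)

/-- Condition (c) forbids inclusions between the child sets of distinct hidden vertices. -/
theorem eq_of_chSet_subset_chSet (hmm : IsMeasurementModel E Xs Hs) (hc : CondC E Xs Hs)
    {h h' : V} (hh : h ∈ Hs) (hh' : h' ∈ Hs) (hsub : chSet E Xs h ⊆ chSet E Xs h') :
    h = h' := by
  by_contra hne
  have mem {k : V} (hk : k ∈ Hs) : {k} ∈ completeFamily Hs := .inr ⟨k, hk, rfl⟩
  have h₁ : dconn (intervene E {h}) ∅ h h' := by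
    by_contra hsep
    obtain ⟨x, hx, x', hx', hxx'⟩ := hc _ (mem hh) h hh h' hh' hne hsep
    exact hxx' (dconn_intervene_of_mem_chSet hmm (by simpa) (hsub hx) hx')
  have h₂ : dconn (intervene E {h'}) ∅ h' h := by
    by_contra hsep
    obtain ⟨x', hx', x, hx, hxx'⟩ := hc _ (mem hh') h' hh' h hh (Ne.symm hne) hsep
    exact hxx' (dconn_intervene_of_mem_chSet hmm (by simpa) hx' (hsub hx))
  exact hmm.1 h ((transGen_of_dconn_intervene_singleton hne h₁).trans
    (transGen_of_dconn_intervene_singleton (Ne.symm hne) h₂))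

/-- Without non-replaceable imaginary subsets, the child sets of hidden vertices are
inclusion-maximal among the valid subsets. -/
theorem maximal_validSubset_chSet [Finite V] (hmm : IsMeasurementModel E Xs Hs)
    (hc : CondC E Xs Hs)
    (hnoimg : ∀ X' : Set V,
      ¬ (ImaginarySubset E Xs Hs X' ∧ ¬ ReplaceableSubset E Xs Hs X'))
    {h : V} (hh : h ∈ Hs) : Maximal (ValidSubset E Xs Hs) (chSet E Xs h) := by
  obtain ⟨M, hle, hM⟩ :=
    (Set.toFinite {X' | ValidSubset E Xs Hs X'}).exists_le_maximal (validSubset_chSet hmm h)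
  have hM : Maximal (ValidSubset E Xs Hs) M := hM
  obtain ⟨h', hh', hMh'⟩ : ∃ h' ∈ Hs, M ⊆ chSet E Xs h' := by
    by_contra himg
    exact hnoimg M ⟨⟨maxValidSubset_of_maximal hM, himg⟩, not_replaceableSubset_of_maximal hM⟩
  obtain rfl := eq_of_chSet_subset_chSet hmm hc hh hh' (hle.trans hMh')
  rwa [Set.Subset.antisymm hle hMh']

end

/-- If no maximal valid subset is both imaginary and non-replaceable,
then a subset of the observed vertices is a non-replaceable maximal valid subset iff it
is the child set of some hidden vertex. -/
theorem statement12 {V : Type u} [Fintype V] (E : V → V → Prop) (Xs Hs : Set V)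
    (hmm : IsMeasurementModel E Xs Hs)
    (hmax : GraphMaximal E Xs Hs) (hc : CondC E Xs Hs)
    (hnoimg : ∀ X' : Set V,
        ¬ (ImaginarySubset E Xs Hs X' ∧ ¬ ReplaceableSubset E Xs Hs X')) :
    ∀ X' : Set V, X' ⊆ Xs →
      ((MaxValidSubset E Xs Hs X' ∧ ¬ ReplaceableSubset E Xs Hs X') ↔
        ∃ h ∈ Hs, chSet E Xs h = X') := by
  intro X' _
  constructor
  · rintro ⟨hX', hrep⟩
    obtain ⟨h, hh, hsub⟩ : ∃ h ∈ Hs, X' ⊆ chSet E Xs h := by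
      by_contra himg
      exact hnoimg X' ⟨⟨hX', himg⟩, hrep⟩
    refine ⟨h, hh, ?_⟩
    by_contra hne
    exact hrep ⟨hX', _,
      maxValidSubset_of_maximal (maximal_validSubset_chSet hmm hc hnoimg hh),
      hsub.ssubset_of_ne (Ne.symm hne)⟩
  · rintro ⟨h, hh, rfl⟩
    have hmaximal := maximal_validSubset_chSet hmm hc hnoimg hh
    exact ⟨maxValidSubset_of_maximal hmaximal, not_replaceableSubset_of_maximal hmaximal⟩
end

section
/- Let G be a measurement model satisfying graphical condition (c), with 𝓘 the complete family of intervention targets. Then the subset condition holds: for all distinct hidden vertices h ≠ h′, ch(h) is not a subset of ch(h′). -/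
universe u

/-- A path without inner colliders whose first edge points forward is directed. -/
theorem transGen_of_forward_edge {V : Type u} {F : V → V → Prop} {b : V} :
    ∀ (l : List V) (u v : V), F u v →
      List.IsChain (fun u v => F u v ∨ F v u) (u :: v :: l) →
      TriplesActive F ∅ (u :: v :: l) → (u :: v :: l).getLast? = some b →
      Relation.TransGen F u b
  | [], u, v, huv, _, _, hb => by
    obtain rfl : v = b := by simpa using hb
    exact .single huv
  | w :: l, u, v, huv, hch, ht, hb => by
    have htail := (List.isChain_cons_cons.mp hch).2
    have hvw : F v w := by
      rcases (List.isChain_cons_cons.mp htail).1 with hvw | hwv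
      · exact hvw
      · obtain ⟨d, -, hd⟩ := ht.1.1 ⟨huv, hwv⟩
        exact hd.elim
    exact .head huv
      (transGen_of_forward_edge l v w hvw htail ht.2 (by rwa [List.getLast?_cons_cons] at hb))

/-- A parentless vertex is an ancestor of every other vertex it is d-connected to. -/
theorem transGen_of_dconn {V : Type u} {F : V → V → Prop} {a b : V} (hab : a ≠ b)
    (ha : ∀ w, ¬ F w a) (h : dconn F ∅ a b) : Relation.TransGen F a b := by
  obtain ⟨p, -, hhead, hlast, hch, ht⟩ := h
  match p, hhead, hlast, hch, ht with
  | [c], hhead, hlast, _, _ =>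
    simp only [List.head?_cons, List.getLast?_singleton, Option.some.injEq] at hhead hlast
    exact absurd (hhead.symm.trans hlast) hab
  | c :: v :: l, hhead, hlast, hch, ht =>
    obtain rfl : c = a := by simpa using hhead
    exact transGen_of_forward_edge l c v
      ((List.isChain_cons_cons.mp hch).1.resolve_right (ha v)) hch ht hlast

/-- Children of a common parent are d-connected. -/
theorem dconn_of_common_parent {V : Type u} {F : V → V → Prop} {k x y : V}
    (hx : F k x) (hy : F k y) (hxk : ¬ F x k) (hkx : k ≠ x) (hky : k ≠ y) :
    dconn F ∅ x y := by
  by_cases hxy : x = y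
  · subst hxy
    exact ⟨[x], by simp, rfl, rfl, .singleton _, trivial⟩
  · refine ⟨[x, k, y], by simp [hxy, hkx.symm, hky], rfl, rfl, .cons_cons (.inr hx) (.cons_cons (.inl hy) (.singleton _)),
      ⟨fun hc => (hxk hc.1).elim, fun _ hk => hk⟩, trivial⟩

/-- If two distinct hidden vertices have nested child sets, each of them remains d-connected
to the other under the intervention targeting it, hence is an ancestor of the other. -/
theorem transGen_of_children_comparable {V : Type u} {E : V → V → Prop} {Xs Hs : Set V}
    (hmm : IsMeasurementModel E Xs Hs) (hc : CondC E Xs Hs) {a b : V} (ha : a ∈ Hs)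
    (hb : b ∈ Hs) (hab : a ≠ b)
    (hsub : chSet E Xs a ⊆ chSet E Xs b ∨ chSet E Xs b ⊆ chSet E Xs a) :
    Relation.TransGen E a b := by
  obtain ⟨-, hdisj, hedge⟩ := hmm
  have hne : ∀ {x k}, x ∈ Xs → k ∈ Hs → k ≠ x := fun hx hk hkx =>
    Set.disjoint_left.mp hdisj hx (hkx ▸ hk)
  have hconn : dconn (intervene E {a}) ∅ a b := by
    by_contra hsep
    obtain ⟨x, hx, y, hy, hxy⟩ := hc {a} (Or.inr ⟨a, ha, rfl⟩) a ha b hb hab hsep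
    obtain ⟨k, hk, hkx, hky⟩ : ∃ k ∈ Hs, E k x ∧ E k y := by
      rcases hsub with hsub | hsub
      · exact ⟨b, hb, (hsub hx).2, hy.2⟩
      · exact ⟨a, ha, hx.2, (hsub hy).2⟩
    exact hxy (dconn_of_common_parent ⟨hkx, (hne hx.1 ha).symm⟩ ⟨hky, (hne hy.1 ha).symm⟩
      (fun hxk => hne hx.1 (hedge _ _ hxk.1).1 rfl) (hne hx.1 hk) (hne hy.1 hk))
  exact Relation.TransGen.mono (fun _ _ he => he.1) _ _
    (transGen_of_dconn hab (fun w hw => hw.2 rfl) hconn)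

/-- In a measurement model satisfying condition (c) with the complete
family of intervention targets, the subset condition holds: no hidden vertex's child set
is contained in another's. -/
theorem statement13 {V : Type u} [Fintype V] (E : V → V → Prop) (Xs Hs : Set V)
    (hmm : IsMeasurementModel E Xs Hs) (hc : CondC E Xs Hs) :
    ∀ h ∈ Hs, ∀ h' ∈ Hs, h ≠ h' → ¬ (chSet E Xs h ⊆ chSet E Xs h') := by
  intro h hh h' hh' hne hsub
  exact hmm.1 h ((transGen_of_children_comparable hmm hc hh hh' hne (.inl hsub)).trans
    (transGen_of_children_comparable hmm hc hh' hh hne.symm (.inr hsub)))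
end
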